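/- arXiv:1205.3007 — 4 statements merged into one kernel-verified Lean document; each statement's English description precedes it below -/
import Mathlib

section
/- Let R be a ring, let H and H′ be monoform right R-modules, let E be an injective hull of H and let E′ be an injective hull of H′. Then E is an indecomposable module, and E is isomorphic to E′ if and only if H and H′ are atom-equivalent. -/
universe u v w

/-- A module `M` over `A` is *monoform* if it is nonzero and for every nonzero submodule `N`
of `M` there is no nonzero submodule of `M` isomorphic to a submodule of `M ⧸ N`.
A right `R`-module is a module over `Rᵐᵒᵖ`. -/
def IsMonoform (A : Type u) [Ring A] (M : Type v) [AddCommGroup M] [Module A M] : Prop :=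
  Nontrivial M ∧ ∀ N : Submodule A M, N ≠ ⊥ →
    ¬ ∃ (C : Submodule A M) (f : C →ₗ[A] M ⧸ N), C ≠ ⊥ ∧ Function.Injective f

/-- Two modules are *atom-equivalent* if there is a nonzero module admitting injective
homomorphisms into both of them. -/
def AtomEquivalent (A : Type u) [Ring A] (H : Type v) [AddCommGroup H] [Module A H]
    (H' : Type w) [AddCommGroup H'] [Module A H'] : Prop :=
  ∃ (C : Type (max v w)) (_ : AddCommGroup C) (_ : Module A C), Nontrivial C ∧
    (∃ f : C →ₗ[A] H, Function.Injective f) ∧ (∃ g : C →ₗ[A] H', Function.Injective g)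

/-- A submodule is *essential* if it meets every nonzero submodule nontrivially. -/
def IsEssentialSubmodule {A : Type u} [Ring A] {M : Type v} [AddCommGroup M] [Module A M]
    (N : Submodule A M) : Prop :=
  ∀ L : Submodule A M, L ≠ ⊥ → N ⊓ L ≠ ⊥

/-- A module is *indecomposable* if it is nonzero and is not the direct sum of two nonzero
submodules. -/
def IsIndecomposableModule (A : Type u) [Ring A] (M : Type v) [AddCommGroup M] [Module A M] :
    Prop :=
  Nontrivial M ∧
    ¬ ∃ N₁ N₂ : Submodule A M, N₁ ≠ ⊥ ∧ N₂ ≠ ⊥ ∧ N₁ ⊓ N₂ = ⊥ ∧ N₁ ⊔ N₂ = ⊤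

/-- The range of an injective linear map from a nonzero module is nonzero. -/
theorem range_ne_bot_of_injective {A : Type u} [Ring A] {M N : Type*} [AddCommGroup M]
    [Module A M] [AddCommGroup N] [Module A N] [Nontrivial M] {f : M →ₗ[A] N}
    (hf : Function.Injective f) : LinearMap.range f ≠ ⊥ := by
  obtain ⟨x, hx⟩ := exists_ne (0 : M)
  rw [Submodule.ne_bot_iff]
  exact ⟨f x, LinearMap.mem_range_self f x, (map_ne_zero_iff f hf).2 hx⟩

/-- Every nonzero submodule of a monoform module is essential. -/
theorem IsMonoform.isEssentialSubmodule {A : Type u} [Ring A] {M : Type v} [AddCommGroup M]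
    [Module A M] (h : IsMonoform A M) {N : Submodule A M} (hN : N ≠ ⊥) :
    IsEssentialSubmodule N := by
  intro L hL hNL
  refine h.2 N hN ⟨L, N.mkQ ∘ₗ L.subtype, hL, ?_⟩
  rw [← LinearMap.ker_eq_bot, LinearMap.ker_comp, Submodule.ker_mkQ,
    ← Submodule.disjoint_iff_comap_eq_bot]
  exact (disjoint_iff.2 hNL).symm

/-- If every nonzero submodule of `M` is essential, then the same holds for every essential
extension of `M`. -/
theorem IsEssentialSubmodule.of_range {A : Type u} [Ring A] {M : Type v} [AddCommGroup M]
    [Module A M] {E : Type w} [AddCommGroup E] [Module A E] {i : M →ₗ[A] E}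
    (hi : Function.Injective i) (hiE : IsEssentialSubmodule (LinearMap.range i))
    (hM : ∀ N : Submodule A M, N ≠ ⊥ → IsEssentialSubmodule N)
    {N : Submodule A E} (hN : N ≠ ⊥) : IsEssentialSubmodule N := by
  have comap_ne_bot (P : Submodule A E) (hP : P ≠ ⊥) : P.comap i ≠ ⊥ := by
    intro h
    refine hiE P hP ?_
    rw [← Submodule.map_comap_eq, h, Submodule.map_bot]
  intro L hL h
  refine hM _ (comap_ne_bot N hN) _ (comap_ne_bot L hL) ?_
  rw [← Submodule.comap_inf, h, Submodule.comap_bot, LinearMap.ker_eq_bot.2 hi]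

/-- A linear map that is injective on an essential submodule is injective. -/
theorem IsEssentialSubmodule.injective_of_comp {A : Type u} [Ring A] {C M N : Type*}
    [AddCommGroup C] [Module A C] [AddCommGroup M] [Module A M] [AddCommGroup N] [Module A N]
    {a : C →ₗ[A] M} (ha : IsEssentialSubmodule (LinearMap.range a)) {g : M →ₗ[A] N}
    (hg : Function.Injective (g ∘ₗ a)) : Function.Injective g := by
  rw [← LinearMap.ker_eq_bot]
  by_contra hker
  refine ha _ hker ?_
  rw [← Submodule.map_comap_eq, ← LinearMap.ker_comp, LinearMap.ker_eq_bot.2 hg,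
    Submodule.map_bot]

/-- Injective modules all of whose nonzero submodules are essential are isomorphic as soon as
some nonzero module embeds into both. -/
theorem nonempty_linearEquiv_of_common_submodule {A : Type u} [Ring A] {C E E' : Type v}
    [AddCommGroup C] [Module A C] [Nontrivial C]
    [AddCommGroup E] [Module A E] [Module.Injective A E]
    [AddCommGroup E'] [Module A E'] [Module.Injective A E']
    (hE : ∀ N : Submodule A E, N ≠ ⊥ → IsEssentialSubmodule N)
    (hE' : ∀ N : Submodule A E', N ≠ ⊥ → IsEssentialSubmodule N)
    {a : C →ₗ[A] E} (ha : Function.Injective a) {b : C →ₗ[A] E'} (hb : Function.Injective b) :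
    Nonempty (E ≃ₗ[A] E') := by
  obtain ⟨g, hg⟩ := Module.Injective.out a ha b
  have g_inj : Function.Injective g :=
    (hE _ (range_ne_bot_of_injective ha)).injective_of_comp (a := a)
      (by rwa [show g ∘ₗ a = b from LinearMap.ext hg])
  obtain ⟨r, hr⟩ := Module.Injective.out g g_inj (LinearMap.id : E →ₗ[A] E)
  have : Nontrivial E := ha.nontrivial
  have r_inj : Function.Injective r :=
    (hE' _ (range_ne_bot_of_injective g_inj)).injective_of_comp (a := g)
      (by rw [show r ∘ₗ g = LinearMap.id from LinearMap.ext hr]; exact Function.injective_id)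
  exact ⟨(LinearEquiv.ofBijective r ⟨r_inj, fun x => ⟨g x, hr x⟩⟩).symm⟩

/-- Modules with isomorphic essential extensions are atom-equivalent if they are nonzero. -/
theorem AtomEquivalent.of_linearEquiv {A : Type u} [Ring A] {H H' E E' : Type v}
    [AddCommGroup H] [Module A H] [AddCommGroup H'] [Module A H'] [Nontrivial H']
    [AddCommGroup E] [Module A E] [AddCommGroup E'] [Module A E']
    {i : H →ₗ[A] E} (hi : Function.Injective i)
    (hiE : IsEssentialSubmodule (LinearMap.range i))
    {i' : H' →ₗ[A] E'} (hi' : Function.Injective i')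
    (e : E ≃ₗ[A] E') : AtomEquivalent A H H' := by
  have hj : Function.Injective (e.symm.toLinearMap ∘ₗ i') := e.symm.injective.comp hi'
  let j := LinearEquiv.ofInjective (e.symm.toLinearMap ∘ₗ i') hj
  let k := LinearEquiv.ofInjective i hi
  have hne : LinearMap.range (e.symm.toLinearMap ∘ₗ i') ≠ ⊥ :=
    range_ne_bot_of_injective hj
  let C := LinearMap.range i ⊓ LinearMap.range (e.symm.toLinearMap ∘ₗ i')
  exact ⟨C, inferInstance, inferInstance, Submodule.nontrivial_iff_ne_bot.2 (hiE _ hne),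
    ⟨k.symm.toLinearMap ∘ₗ Submodule.inclusion inf_le_left,
      k.symm.injective.comp (Submodule.inclusion_injective _)⟩,
    ⟨j.symm.toLinearMap ∘ₗ Submodule.inclusion inf_le_right,
      j.symm.injective.comp (Submodule.inclusion_injective _)⟩⟩

/-- The injective hull of a monoform right `R`-module is indecomposable, and two such hulls are
isomorphic if and only if the monoform modules are atom-equivalent. -/
theorem injective_hull_indecomposable_and_iso_iff_atomEquivalent (R : Type u) [Ring R]
    (H : Type v) [AddCommGroup H] [Module Rᵐᵒᵖ H]
    (H' : Type v) [AddCommGroup H'] [Module Rᵐᵒᵖ H']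
    (E : Type v) [AddCommGroup E] [Module Rᵐᵒᵖ E] [Module.Injective Rᵐᵒᵖ E]
    (E' : Type v) [AddCommGroup E'] [Module Rᵐᵒᵖ E'] [Module.Injective Rᵐᵒᵖ E']
    (hH : IsMonoform Rᵐᵒᵖ H) (hH' : IsMonoform Rᵐᵒᵖ H')
    (i : H →ₗ[Rᵐᵒᵖ] E) (hi : Function.Injective i)
    (hiE : IsEssentialSubmodule (LinearMap.range i))
    (i' : H' →ₗ[Rᵐᵒᵖ] E') (hi' : Function.Injective i')
    (hiE' : IsEssentialSubmodule (LinearMap.range i')) :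
    IsIndecomposableModule Rᵐᵒᵖ E ∧
      (Nonempty (E ≃ₗ[Rᵐᵒᵖ] E') ↔ AtomEquivalent Rᵐᵒᵖ H H') := by
  have : Nontrivial H := hH.1
  have : Nontrivial H' := hH'.1
  have hE (N : Submodule Rᵐᵒᵖ E) (hN : N ≠ ⊥) : IsEssentialSubmodule N :=
    .of_range hi hiE (fun _ => hH.isEssentialSubmodule) hN
  have hE' (N : Submodule Rᵐᵒᵖ E') (hN : N ≠ ⊥) : IsEssentialSubmodule N :=
    .of_range hi' hiE' (fun _ => hH'.isEssentialSubmodule) hN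
  refine ⟨⟨hi.nontrivial, ?_⟩, ?_, ?_⟩
  · rintro ⟨N₁, N₂, h₁, h₂, h, -⟩
    exact hE N₁ h₁ N₂ h₂ h
  · rintro ⟨e⟩
    exact .of_linearEquiv hi hiE hi' e
  · rintro ⟨C, _, _, _, ⟨f, hf⟩, ⟨g, hg⟩⟩
    exact nonempty_linearEquiv_of_common_submodule hE hE'
      (a := i ∘ₗ f) (hi.comp hf) (b := i' ∘ₗ g) (hi'.comp hg)
end

section
/- Let R be a ring, let E be a nonzero indecomposable injective right R-module, and let f be an endomorphism of E that is not an automorphism. Then f is not injective, and every monoform submodule H of E satisfies H ⊆ ker f. -/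
universe u v w

/-- Any submodule disjoint from `B` is contained in one that is maximal with this property. -/
theorem Submodule.exists_maximal_disjoint {A : Type u} [Ring A] {M : Type v} [AddCommGroup M]
    [Module A M] {K B : Submodule A M} (h : Disjoint K B) :
    ∃ K', K ≤ K' ∧ Maximal (fun L : Submodule A M => Disjoint L B) K' := by
  refine zorn_le_nonempty₀ {L : Submodule A M | Disjoint L B} (fun c hc hchain _ _ => ?_) K h
  exact ⟨sSup c, hchain.directedOn.disjoint_sSup_left.2 fun _ ha => hc ha,
    fun _ hz => le_sSup hz⟩

/-- Given disjoint submodules `K` and `L` of an injective module, there is an endomorphism which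
is the identity on `K` and zero on `L`. -/
theorem Module.Injective.exists_end_of_disjoint {A : Type u} [Ring A] {E : Type v}
    [AddCommGroup E] [Module A E] [Module.Injective A E] {K L : Submodule A E}
    (h : Disjoint K L) :
    ∃ p : Module.End A E, (∀ x ∈ K, p x = x) ∧ ∀ x ∈ L, p x = 0 := by
  have hinj : Function.Injective (K.subtype.coprod L.subtype) := by
    rw [← LinearMap.ker_eq_bot, LinearMap.ker_coprod_of_disjoint_range _ _ (by simpa using h)]
    simp
  obtain ⟨p, hp⟩ := Module.Injective.out (K.subtype.coprod L.subtype) hinj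
    (K.subtype.comp (LinearMap.fst A K L))
  exact ⟨p, fun x hx => by simpa using hp (⟨x, hx⟩, 0), fun x hx => by simpa using hp (0, ⟨x, hx⟩)⟩

/-- An indecomposable injective module is uniform. -/
theorem IsIndecomposableModule.inf_ne_bot {A : Type u} [Ring A] {E : Type v} [AddCommGroup E]
    [Module A E] [Module.Injective A E] (hE : IsIndecomposableModule A E) {K L : Submodule A E}
    (hK : K ≠ ⊥) (hL : L ≠ ⊥) : K ⊓ L ≠ ⊥ := by
  intro h
  obtain ⟨L', hLL', hL'⟩ := Submodule.exists_maximal_disjoint (disjoint_iff.2 h).symm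
  obtain ⟨K', hKK', hK'⟩ := Submodule.exists_maximal_disjoint hL'.prop.symm
  have hKL : Disjoint K' L' := hK'.prop
  have hL'' : ∀ L'', L' ≤ L'' → Disjoint L'' K' → L'' ≤ L' := fun L'' hle hd =>
    hL'.le_of_ge (hd.mono_right hKK') hle
  obtain ⟨p, hpK, hpL⟩ := Module.Injective.exists_end_of_disjoint hKL
  have hcomap : L'.comap p ≤ L' := by
    refine hL'' _ (fun x hx => by simp [hpL x hx]) (Submodule.disjoint_def.2 fun x hx hxK => ?_)
    rw [Submodule.mem_comap, hpK x hxK] at hx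
    exact Submodule.disjoint_def.1 hKL x hxK hx
  have hrange : LinearMap.range p ≤ K' := by
    refine hK'.le_of_ge (Submodule.disjoint_def.2 ?_) fun x hx => ⟨x, hpK x hx⟩
    rintro _ ⟨x, rfl⟩ hx
    exact hpL x (hcomap hx)
  refine hE.2 ⟨K', LinearMap.ker p, ne_bot_of_le_ne_bot hK hKK',
    ne_bot_of_le_ne_bot hL fun x hx => hpL x (hLL' hx), ?_, ?_⟩
  · rw [← disjoint_iff, Submodule.disjoint_def]
    intro x hx hx0
    rw [← hpK x hx]
    exact hx0
  · refine eq_top_iff.2 fun x _ => Submodule.mem_sup.2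
      ⟨p x, hrange ⟨x, rfl⟩, x - p x, ?_, add_sub_cancel _ _⟩
    rw [LinearMap.mem_ker, map_sub, hpK _ (hrange ⟨x, rfl⟩), sub_self]

/-- An injective endomorphism of an indecomposable injective module is bijective. -/
theorem IsIndecomposableModule.bijective_of_injective {A : Type u} [Ring A] {E : Type v}
    [AddCommGroup E] [Module A E] [Module.Injective A E] (hE : IsIndecomposableModule A E)
    {f : Module.End A E} (hf : Function.Injective f) : Function.Bijective f := by
  have := hE.1
  obtain ⟨g, hg⟩ := Module.Injective.out f hf LinearMap.id
  have hrange : LinearMap.range f ≠ ⊥ := by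
    obtain ⟨x, hx⟩ := exists_ne (0 : E)
    exact (Submodule.ne_bot_iff _).2 ⟨f x, ⟨x, rfl⟩, (map_ne_zero_iff f hf).2 hx⟩
  have hker : LinearMap.ker g = ⊥ := by
    by_contra hker
    refine hE.inf_ne_bot hrange hker (disjoint_iff.1 (Submodule.disjoint_def.2 ?_))
    rintro _ ⟨x, rfl⟩ hx
    rw [LinearMap.mem_ker, hg, LinearMap.id_apply] at hx
    rw [hx, map_zero]
  exact ⟨hf, fun y => ⟨g y, LinearMap.ker_eq_bot.1 hker (hg _)⟩⟩

/-- If every two nonzero submodules of `M` meet nontrivially, a monoform submodule of `M` is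
killed by every noninjective endomorphism of `M`. -/
theorem IsMonoform.le_ker {A : Type u} [Ring A] {M : Type v} [AddCommGroup M] [Module A M]
    (hM : ∀ K L : Submodule A M, K ≠ ⊥ → L ≠ ⊥ → K ⊓ L ≠ ⊥) {f : Module.End A M}
    (hf : ¬ Function.Injective f) {H : Submodule A M} (hH : IsMonoform A H) :
    H ≤ LinearMap.ker f := by
  have hbot : H ≠ ⊥ := (Submodule.nontrivial_iff_ne_bot).1 hH.1
  by_contra hle
  have hcomap : ∀ K : Submodule A M, K ≠ ⊥ → K.comap H.subtype ≠ ⊥ := fun K hK h =>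
    hM H K hbot hK (by rw [← Submodule.map_comap_subtype, h, Submodule.map_bot])
  have hmap : LinearMap.range (f.domRestrict H) ≠ ⊥ := by
    refine fun h => hle fun x hx => ?_
    exact LinearMap.congr_fun (LinearMap.range_eq_bot.1 h) ⟨x, hx⟩
  refine hH.2 (LinearMap.ker (f.domRestrict H))
    (hcomap (LinearMap.ker f) fun h => hf (LinearMap.ker_eq_bot.1 h))
    ⟨(LinearMap.range (f.domRestrict H)).comap H.subtype,
      (f.domRestrict H).quotKerEquivRange.symm.toLinearMap ∘ₗ
        H.subtype.restrict (fun _ hx => hx), hcomap _ hmap, ?_⟩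
  refine (f.domRestrict H).quotKerEquivRange.symm.injective.comp fun x y hxy => ?_
  have h := congrArg Subtype.val hxy
  exact Subtype.ext (Subtype.ext h)

/-- If `E` is a nonzero indecomposable injective right `R`-module and `f` is an endomorphism of
`E` which is not an automorphism, then `f` is not injective and every monoform submodule of `E`
is contained in `ker f`. -/
theorem monoform_submodule_le_ker (R : Type u) [Ring R]
    (E : Type v) [AddCommGroup E] [Module Rᵐᵒᵖ E] [Module.Injective Rᵐᵒᵖ E]
    (hE : IsIndecomposableModule Rᵐᵒᵖ E)
    (f : Module.End Rᵐᵒᵖ E) (hf : ¬ Function.Bijective f) :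
    ¬ Function.Injective f ∧
      ∀ H : Submodule Rᵐᵒᵖ E, IsMonoform Rᵐᵒᵖ H → H ≤ LinearMap.ker f := by
  have hinj : ¬ Function.Injective f := fun h => hf (hE.bijective_of_injective h)
  exact ⟨hinj, fun H hH => hH.le_ker (fun _ _ => hE.inf_ne_bot) hinj⟩
end

section
/- Let R be a ring, let H be a monoform right R-module with injective hull E, and let M be a right R-module. Then M contains a monoform submodule atom-equivalent to H if and only if there exist a nonzero submodule U of E and an injective R-homomorphism U → M. -/
universe u v w

/-- A nonzero module embedding into a monoform module is monoform. -/
theorem IsMonoform.of_injective {A : Type u} [Ring A] {K : Type w} [AddCommGroup K] [Module A K]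
    {M : Type v} [AddCommGroup M] [Module A M] (hM : IsMonoform A M) [Nontrivial K]
    (j : K →ₗ[A] M) (hj : Function.Injective j) : IsMonoform A K := by
  refine ⟨inferInstance, fun N hN ⟨C, f, hC, hf⟩ => ?_⟩
  have map_ne_bot (P : Submodule A K) (hP : P ≠ ⊥) : P.map j ≠ ⊥ := fun h =>
    hP (Submodule.map_injective_of_injective hj (h.trans (Submodule.map_bot j).symm))
  have hq : Function.Injective (N.mapQ (N.map j) j (Submodule.le_comap_map j N)) := by
    rw [← LinearMap.ker_eq_bot, Submodule.ker_mapQ, Submodule.comap_map_eq_of_injective hj,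
      Submodule.mkQ_map_self]
  refine hM.2 (N.map j) (map_ne_bot N hN) ⟨C.map j,
    N.mapQ (N.map j) j (Submodule.le_comap_map j N) ∘ₗ f ∘ₗ
      (Submodule.equivMapOfInjective j hj C).symm.toLinearMap, map_ne_bot C hC, ?_⟩
  exact hq.comp (hf.comp (Submodule.equivMapOfInjective j hj C).symm.injective)

/-- Let `H` be a monoform right `R`-module with injective hull `E` and let `M` be a right
`R`-module.  Then `M` contains a monoform submodule atom-equivalent to `H` if and only if some
nonzero submodule `U` of `E` admits an injective homomorphism `U → M`. -/
theorem contains_atomEquivalent_monoform_iff (R : Type u) [Ring R]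
    (H : Type v) [AddCommGroup H] [Module Rᵐᵒᵖ H] (hH : IsMonoform Rᵐᵒᵖ H)
    (E : Type v) [AddCommGroup E] [Module Rᵐᵒᵖ E] [Module.Injective Rᵐᵒᵖ E]
    (i : H →ₗ[Rᵐᵒᵖ] E) (hi : Function.Injective i)
    (hiE : IsEssentialSubmodule (LinearMap.range i))
    (M : Type v) [AddCommGroup M] [Module Rᵐᵒᵖ M] :
    (∃ H' : Submodule Rᵐᵒᵖ M, IsMonoform Rᵐᵒᵖ H' ∧ AtomEquivalent Rᵐᵒᵖ H H') ↔
    (∃ U : Submodule Rᵐᵒᵖ E, U ≠ ⊥ ∧ ∃ g : U →ₗ[Rᵐᵒᵖ] M, Function.Injective g) := by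
  constructor
  · rintro ⟨H', -, C, _, _, _, ⟨f, hf⟩, ⟨g, hg⟩⟩
    have hif : Function.Injective (i ∘ₗ f) := hi.comp hf
    refine ⟨LinearMap.range (i ∘ₗ f), fun h => ?_,
      H'.subtype ∘ₗ g ∘ₗ (LinearEquiv.ofInjective (i ∘ₗ f) hif).symm.toLinearMap,
      H'.injective_subtype.comp (hg.comp (LinearEquiv.injective _))⟩
    obtain ⟨x, hx⟩ := exists_ne (0 : C)
    rw [LinearMap.range_eq_bot] at h
    exact hx (hif (by simp only [h, LinearMap.zero_apply]))
  · rintro ⟨U, hU, g, hg⟩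
    have hL : Nontrivial (U.comap i) := by
      rw [Submodule.nontrivial_iff_ne_bot]
      intro h
      apply hiE U hU
      rw [← Submodule.map_comap_eq, h, Submodule.map_bot]
    let k : U.comap i →ₗ[Rᵐᵒᵖ] U := i.restrict (fun _ hx => hx)
    have hk : Function.Injective k := fun x y hxy =>
      Subtype.ext (hi (congrArg Subtype.val hxy))
    let e := LinearEquiv.ofInjective (g ∘ₗ k) (hg.comp hk)
    have hR : Nontrivial (LinearMap.range (g ∘ₗ k)) := e.symm.toEquiv.nontrivial
    exact ⟨LinearMap.range (g ∘ₗ k),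
      hH.of_injective ((U.comap i).subtype ∘ₗ e.symm.toLinearMap)
        ((U.comap i).injective_subtype.comp e.symm.injective),
      U.comap i, inferInstance, inferInstance, hL,
      ⟨(U.comap i).subtype, (U.comap i).injective_subtype⟩, ⟨e.toLinearMap, e.injective⟩⟩
end

section
/- Let R be a commutative noetherian ring, let Λ be a ring containing R as a subring of its center such that Λ is finitely generated as an R-module, let p be a prime ideal of R, and let Λ_p = Λ ⊗_R R_p. Then the map Q ↦ QΛ_p restricts to a bijection from {prime two-sided ideals P of Λ with P ∩ R = p} onto the set of maximal two-sided ideals of Λ_p. -/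
universe u v

open scoped TensorProduct

/-- The annihilator of a right `Λ`-module (i.e. a `Λᵐᵒᵖ`-module) `S`, as a two-sided ideal of
`Λ`: it consists of all `a : Λ` with `S • a = 0`. -/
def rightAnnihilator (Λ : Type u) [Ring Λ] (S : Type v) [AddCommGroup S]
    [Module Λᵐᵒᵖ S] : TwoSidedIdeal Λ :=
  TwoSidedIdeal.mk' {a : Λ | ∀ x : S, MulOpposite.op a • x = 0}
    (fun x => by simp)
    (fun {a b} ha hb x => by
      rw [Set.mem_setOf_eq] at ha hb
      rw [MulOpposite.op_add, add_smul, ha x, hb x, add_zero])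
    (fun {a} ha x => by
      rw [Set.mem_setOf_eq] at ha
      rw [MulOpposite.op_neg, neg_smul, ha x, neg_zero])
    (fun {a b} hb x => by
      rw [Set.mem_setOf_eq] at hb
      rw [MulOpposite.op_mul, mul_smul]; exact hb _)
    (fun {a b} ha x => by
      rw [Set.mem_setOf_eq] at ha
      rw [MulOpposite.op_mul, mul_smul, ha x, smul_zero])

/-- A two-sided ideal `P` of `Λ` is *prime* if it is proper and `a Λ b ⊆ P` implies `a ∈ P` or
`b ∈ P`. -/
def IsPrimeTwoSided {Λ : Type u} [Ring Λ] (P : TwoSidedIdeal Λ) : Prop :=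
  P ≠ ⊤ ∧ ∀ a b : Λ, (∀ x : Λ, a * x * b ∈ P) → a ∈ P ∨ b ∈ P

/-- A two-sided ideal of `Λ` is *maximal* if it is a maximal element of the set of proper
two-sided ideals of `Λ`. -/
def IsMaximalTwoSided {Λ : Type u} [Ring Λ] (P : TwoSidedIdeal Λ) : Prop :=
  P ≠ ⊤ ∧ ∀ Q : TwoSidedIdeal Λ, P < Q → Q = ⊤

/-- A two-sided ideal of `Λ`, viewed as a submodule of `Λ` as a right module over itself. -/
def TwoSidedIdeal.toRightSubmodule {Λ : Type u} [Ring Λ] (P : TwoSidedIdeal Λ) :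
    Submodule Λᵐᵒᵖ Λ where
  carrier := P
  zero_mem' := P.zero_mem
  add_mem' := P.add_mem
  smul_mem' := fun c x hx => by
    rw [MulOpposite.smul_eq_mul_unop]
    exact P.mul_mem_right _ _ hx

/-- The central localization `Λ_p = Λ ⊗_R R_p` of an `R`-algebra `Λ` at a prime ideal `p` of
`R`. -/
noncomputable abbrev LocalizedAlg (R : Type u) [CommRing R] (Λ : Type u) [Ring Λ] [Algebra R Λ]
    (p : Ideal R) [p.IsPrime] : Type u :=
  Localization.AtPrime p ⊗[R] Λ

/-- The canonical ring homomorphism `φ : Λ → Λ_p`. -/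
noncomputable abbrev localizationRingHom (R : Type u) [CommRing R] (Λ : Type u) [Ring Λ]
    [Algebra R Λ] (p : Ideal R) [p.IsPrime] : Λ →+* LocalizedAlg R Λ p :=
  (Algebra.TensorProduct.includeRight (R := R) (A := Localization.AtPrime p) (B := Λ)).toRingHom


/-- The contraction `P ∩ R` of a two-sided ideal of `Λ` to the central subring `R`. -/
def TwoSidedIdeal.contract (R : Type u) [CommRing R] (Λ : Type u) [Ring Λ] [Algebra R Λ]
    (P : TwoSidedIdeal Λ) : Ideal R :=
  Ideal.comap (algebraMap R Λ) (TwoSidedIdeal.asIdeal (R := Λ) P)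

/-- In an Artinian prime ring, every nonzero two-sided ideal is the whole ring. -/
theorem Ideal.eq_top_of_isArtinianRing_of_prime {A : Type*} [Ring A] [IsArtinianRing A]
    (hA : ∀ a b : A, (∀ x, a * x * b = 0) → a = 0 ∨ b = 0)
    (I : Ideal A) [I.IsTwoSided] (hI : I ≠ ⊥) : I = ⊤ := by
  have hJ : Ring.jacobson A = ⊥ := by
    by_contra hne
    obtain ⟨a, haJ, ha⟩ := Submodule.exists_mem_ne_zero_of_ne_bot hne
    have hpow : ∀ n : ℕ, ∃ b ∈ (Ring.jacobson A) ^ n, b ≠ 0 := by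
      intro n
      induction n with
      | zero => exact ⟨a, by simp [Submodule.pow_zero], ha⟩
      | succ n ih =>
        obtain ⟨b, hb, hb0⟩ := ih
        have hx : ∃ x, b * x * a ≠ 0 := by
          by_contra! h
          exact (hA b a h).elim hb0 ha
        obtain ⟨x, hx⟩ := hx
        refine ⟨b * x * a, ?_, hx⟩
        rw [Submodule.pow_succ, mul_assoc]
        exact Ideal.mul_mem_mul hb (Ideal.mul_mem_left _ _ haJ)
    obtain ⟨n, hn⟩ := IsSemiprimaryRing.isNilpotent (R := A)
    obtain ⟨b, hb, hb0⟩ := hpow n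
    rw [hn] at hb
    exact hb0 (by simpa using hb)
  have : IsSemisimpleRing A := IsArtinianRing.isSemisimpleRing_iff_jacobson.mpr hJ
  obtain ⟨L, hL⟩ := exists_isCompl I
  obtain ⟨a, haI, ha⟩ := Submodule.exists_mem_ne_zero_of_ne_bot hI
  have hLbot : L = ⊥ := by
    rw [Submodule.eq_bot_iff]
    intro b hb
    refine (hA a b fun x => ?_).resolve_left ha
    have hmem : a * x * b ∈ I ⊓ L :=
      ⟨I.mul_mem_right _ (I.mul_mem_right _ haI), L.mul_mem_left _ hb⟩
    rwa [hL.inf_eq_bot, Submodule.mem_bot] at hmem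
  simpa [hLbot] using hL.sup_eq_top

/-- A prime two-sided ideal of a finite algebra containing the image of a maximal ideal of the
base ring is maximal. -/
theorem IsPrimeTwoSided.isMaximalTwoSided {S B : Type*} [CommRing S] [Ring B] [Algebra S B]
    [Module.Finite S B] (m : Ideal S) [m.IsMaximal] {P : TwoSidedIdeal B}
    (hP : IsPrimeTwoSided P) (hm : ∀ r ∈ m, algebraMap S B r ∈ P) : IsMaximalTwoSided P := by
  refine ⟨hP.1, fun Q hPQ => ?_⟩
  let A := B ⧸ P.asIdeal
  let := Ideal.Quotient.field m
  have hmk (x : B) : Ideal.Quotient.mk P.asIdeal x = 0 ↔ x ∈ P := by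
    rw [Ideal.Quotient.eq_zero_iff_mem, TwoSidedIdeal.mem_asIdeal]
  let : Algebra (S ⧸ m) A :=
    (Ideal.Quotient.lift m (algebraMap S A) fun r hr => (hmk _).2 (hm r hr)).toAlgebra' <| by
      intro c x
      obtain ⟨c, rfl⟩ := Ideal.Quotient.mk_surjective c
      simpa using Algebra.commutes c x
  have : IsScalarTower S (S ⧸ m) A := .of_algebraMap_eq fun r => rfl
  have : Module.Finite (S ⧸ m) A := .of_restrictScalars_finite S _ _
  have : IsArtinianRing A := .of_finite (S ⧸ m) A
  have hsurj : Function.Surjective (Ideal.Quotient.mk P.asIdeal) := Ideal.Quotient.mk_surjective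
  have hA : ∀ a b : A, (∀ x, a * x * b = 0) → a = 0 ∨ b = 0 := by
    intro a b h
    obtain ⟨a, rfl⟩ := hsurj a
    obtain ⟨b, rfl⟩ := hsurj b
    simp only [hmk]
    exact hP.2 a b fun x => (hmk _).1 (by simpa using h (Ideal.Quotient.mk _ x))
  let I : Ideal A := Q.asIdeal.map (Ideal.Quotient.mk P.asIdeal)
  have hI (y : A) : y ∈ I ↔ ∃ x ∈ Q, Ideal.Quotient.mk P.asIdeal x = y := by
    simpa only [TwoSidedIdeal.mem_asIdeal] using
      Ideal.mem_map_iff_of_surjective (I := Q.asIdeal) (Ideal.Quotient.mk P.asIdeal) hsurj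
  have : I.IsTwoSided := by
    refine ⟨fun {a} b ha => ?_⟩
    obtain ⟨x, hx, rfl⟩ := (hI a).1 ha
    obtain ⟨y, rfl⟩ := hsurj b
    exact (hI _).2 ⟨x * y, Q.mul_mem_right _ _ hx, map_mul _ _ _⟩
  have hIbot : I ≠ ⊥ := by
    intro h
    refine hPQ.not_ge fun x hx => (hmk x).1 ?_
    rw [← Submodule.mem_bot A, ← h]
    exact (hI _).2 ⟨x, hx, rfl⟩
  have hItop := Ideal.eq_top_of_isArtinianRing_of_prime hA I hIbot
  obtain ⟨x, hx, hx1⟩ := (hI 1).1 (hItop ▸ Submodule.mem_top)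
  rw [← Q.one_mem_iff]
  have h1 : 1 - x ∈ Q := hPQ.le <| (hmk _).1 (by simp [hx1])
  simpa using Q.add_mem h1 hx

/-- Maximal two-sided ideals are prime. -/
theorem IsMaximalTwoSided.isPrimeTwoSided {B : Type*} [Ring B] {M : TwoSidedIdeal B}
    (hM : IsMaximalTwoSided M) : IsPrimeTwoSided M := by
  refine ⟨hM.1, fun a b h => or_iff_not_imp_left.2 fun ha => ?_⟩
  let N : TwoSidedIdeal B := TwoSidedIdeal.mk' {x | ∀ y, x * y * b ∈ M}
    (fun y => by simp)
    (fun {u v} hu hv y => by simpa [add_mul] using M.add_mem (hu y) (hv y))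
    (fun {u} hu y => by simpa using hu y)
    (fun {u v} hv y => by simpa [mul_assoc] using M.mul_mem_left u _ (hv y))
    (fun {u v} hu y => by simpa [mul_assoc] using hu (v * y))
  have hN (x : B) : x ∈ N ↔ ∀ y, x * y * b ∈ M := TwoSidedIdeal.mem_mk' ..
  have hlt : M < N := by
    refine lt_of_le_of_ne
      (fun x hx => (hN x).2 fun y => M.mul_mem_right _ _ (M.mul_mem_right _ _ hx)) fun hMN => ?_
    exact ha (hMN ▸ (hN a).2 h)
  have h1 : (1 : B) ∈ N := hM.2 N hlt ▸ TwoSidedIdeal.mem_top _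
  simpa using (hN 1).1 h1 1

/-- A maximal two-sided ideal of a finite algebra over a local ring contains the image of the
maximal ideal of the base ring. -/
theorem IsMaximalTwoSided.algebraMap_mem {S B : Type*} [CommRing S] [IsLocalRing S] [Ring B]
    [Algebra S B] [Module.Finite S B] {M : TwoSidedIdeal B} (hM : IsMaximalTwoSided M)
    {r : S} (hr : r ∈ IsLocalRing.maximalIdeal S) : algebraMap S B r ∈ M := by
  by_contra hrM
  let N : TwoSidedIdeal B := TwoSidedIdeal.mk' {x | ∃ y, x - r • y ∈ M}
    ⟨0, by simp⟩
    (fun {u v} ⟨y, hy⟩ ⟨z, hz⟩ => ⟨y + z, by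
      simpa [smul_add, add_sub_add_comm] using M.add_mem hy hz⟩)
    (fun {u} ⟨y, hy⟩ => ⟨-y, by
      simpa [neg_add_eq_sub, sub_eq_add_neg, add_comm] using M.neg_mem hy⟩)
    (fun {u v} ⟨y, hy⟩ => ⟨u * y, by simpa [mul_sub] using M.mul_mem_left u _ hy⟩)
    (fun {u v} ⟨y, hy⟩ => ⟨y * v, by simpa [sub_mul] using M.mul_mem_right _ v hy⟩)
  have hN (x : B) : x ∈ N ↔ ∃ y, x - r • y ∈ M := TwoSidedIdeal.mem_mk' ..
  have hlt : M < N := by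
    refine lt_of_le_of_ne (fun x hx => (hN x).2 ⟨0, by simpa using hx⟩) fun h => hrM ?_
    exact h ▸ (hN _).2 ⟨1, by simp [Algebra.algebraMap_eq_smul_one]⟩
  have hNtop := hM.2 N hlt
  let M' : Submodule S B := M.asIdeal.restrictScalars S
  have hle : (⊤ : Submodule S B) ≤ M' := by
    refine Submodule.le_of_le_smul_of_le_jacobson_bot Module.Finite.fg_top
      (IsLocalRing.maximalIdeal_le_jacobson _) fun x _ => ?_
    obtain ⟨y, hy⟩ := (hN x).1 (hNtop ▸ TwoSidedIdeal.mem_top _)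
    rw [← sub_add_cancel x (r • y)]
    exact Submodule.add_mem_sup (by simpa [M'] using hy)
      (Submodule.smul_mem_smul hr Submodule.mem_top)
  exact hM.1 ((M.one_mem_iff).1 (hle (x := 1) Submodule.mem_top))

/-- Two-sided ideals of an algebra are stable under scalars from the base ring. -/
theorem TwoSidedIdeal.algebra_smul_mem {R Λ : Type*} [CommRing R] [Ring Λ] [Algebra R Λ]
    (Q : TwoSidedIdeal Λ) (r : R) {x : Λ} (hx : x ∈ Q) : r • x ∈ Q := by
  rw [Algebra.smul_def]
  exact Q.mul_mem_left _ _ hx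

/-- A prime two-sided ideal is saturated with respect to the central elements outside it. -/
theorem IsPrimeTwoSided.mem_of_smul_mem {R Λ : Type*} [CommRing R] [Ring Λ] [Algebra R Λ]
    {P : TwoSidedIdeal Λ} (hP : IsPrimeTwoSided P) {r : R} (hr : algebraMap R Λ r ∉ P) {x : Λ}
    (hx : r • x ∈ P) : x ∈ P := by
  refine (hP.2 (algebraMap R Λ r) x fun y => ?_).resolve_left hr
  rw [Algebra.commutes, mul_assoc, ← Algebra.smul_def]
  exact P.mul_mem_left _ _ hx

section Localization

variable {R Λ B : Type*} [CommRing R] [Ring Λ] [Algebra R Λ] [Ring B] [Algebra R B]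

/-- Every element of a localized algebra becomes the image of an element of the original algebra
after multiplication by a denominator. -/
theorem AlgHom.exists_smul_eq_of_isLocalizedModule (S : Submonoid R) (φ : Λ →ₐ[R] B)
    [IsLocalizedModule S φ.toLinearMap] (x : B) : ∃ s ∈ S, ∃ a, s • x = φ a := by
  obtain ⟨⟨a, s⟩, h⟩ := IsLocalizedModule.surj S φ.toLinearMap x
  exact ⟨s, s.2, a, h⟩

/-- The extension of a two-sided ideal to a localization consists of the fractions with
numerator in the ideal. -/
theorem TwoSidedIdeal.mem_span_image_iff_of_isLocalizedModule (S : Submonoid R) (φ : Λ →ₐ[R] B)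
    [IsLocalizedModule S φ.toLinearMap] (Q : TwoSidedIdeal Λ) (x : B) :
    x ∈ TwoSidedIdeal.span (φ '' Q) ↔ ∃ s ∈ S, ∃ a ∈ Q, s • x = φ a := by
  have hunit : ∀ s ∈ S, ∀ y z : B, s • y = s • z → y = z := fun s hs y z h =>
    IsLocalizedModule.smul_injective φ.toLinearMap (⟨s, hs⟩ : S) h
  constructor
  · let N : TwoSidedIdeal B := TwoSidedIdeal.mk' {x | ∃ s ∈ S, ∃ a ∈ Q, s • x = φ a}
      ⟨1, S.one_mem, 0, Q.zero_mem, by simp⟩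
      (by
        rintro u v ⟨s, hs, a, ha, hu⟩ ⟨t, ht, b, hb, hv⟩
        refine ⟨s * t, S.mul_mem hs ht, t • a + s • b,
          Q.add_mem (Q.algebra_smul_mem _ ha) (Q.algebra_smul_mem _ hb), ?_⟩
        rw [map_add, map_smul, map_smul, ← hu, ← hv, smul_add, smul_smul, smul_smul, mul_comm t])
      (by
        rintro u ⟨s, hs, a, ha, hu⟩
        exact ⟨s, hs, -a, Q.neg_mem ha, by simp [hu]⟩)
      (by
        rintro u v ⟨s, hs, a, ha, hv⟩
        obtain ⟨t, ht, b, hu⟩ := φ.exists_smul_eq_of_isLocalizedModule S u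
        exact ⟨t * s, S.mul_mem ht hs, b * a, Q.mul_mem_left _ _ ha, by
          rw [← smul_mul_smul_comm, hu, hv, map_mul]⟩)
      (by
        rintro u v ⟨s, hs, a, ha, hu⟩
        obtain ⟨t, ht, b, hv⟩ := φ.exists_smul_eq_of_isLocalizedModule S v
        exact ⟨s * t, S.mul_mem hs ht, a * b, Q.mul_mem_right _ _ ha, by
          rw [← smul_mul_smul_comm, hu, hv, map_mul]⟩)
    have hN (x : B) : x ∈ N ↔ ∃ s ∈ S, ∃ a ∈ Q, s • x = φ a := TwoSidedIdeal.mem_mk' ..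
    have hle : TwoSidedIdeal.span (φ '' Q) ≤ N := by
      rw [TwoSidedIdeal.span_le]
      rintro _ ⟨a, ha, rfl⟩
      exact (hN _).2 ⟨1, S.one_mem, a, ha, one_smul _ _⟩
    exact fun hx => (hN x).1 (hle hx)
  · rintro ⟨s, hs, a, ha, hx⟩
    obtain ⟨y, hy⟩ := ((Module.End.isUnit_iff _).1
      (IsLocalizedModule.map_units φ.toLinearMap (⟨s, hs⟩ : S))).2 (1 : B)
    have hy : s • y = 1 := hy
    have hxy : x = y * φ a := by
      rw [← hx, mul_smul_comm, ← smul_mul_assoc, hy, one_mul]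
    rw [hxy]
    exact TwoSidedIdeal.mul_mem_left _ _ _ (TwoSidedIdeal.subset_span ⟨a, ha, rfl⟩)

/-- Extending a prime two-sided ideal disjoint from the denominators and contracting it back
gives the same ideal. -/
theorem IsPrimeTwoSided.map_mem_span_image_iff (S : Submonoid R) (φ : Λ →ₐ[R] B)
    [IsLocalizedModule S φ.toLinearMap] {P : TwoSidedIdeal Λ} (hP : IsPrimeTwoSided P)
    (hPS : ∀ s ∈ S, algebraMap R Λ s ∉ P) (b : Λ) :
    φ b ∈ TwoSidedIdeal.span (φ '' P) ↔ b ∈ P := by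
  refine ⟨fun h => ?_, fun h => TwoSidedIdeal.subset_span ⟨b, h, rfl⟩⟩
  obtain ⟨s, hs, a, ha, h⟩ := (P.mem_span_image_iff_of_isLocalizedModule S φ _).1 h
  obtain ⟨t, ht⟩ := IsLocalizedModule.exists_of_eq (S := S) (f := φ.toLinearMap)
    (x₁ := s • b) (x₂ := a) (by simpa using h)
  refine hP.mem_of_smul_mem (hPS _ hs) (hP.mem_of_smul_mem (hPS _ t.2) ?_)
  have ht : (t : R) • s • b = (t : R) • a := ht
  rw [ht]
  exact P.algebra_smul_mem _ ha

/-- The extension of a prime two-sided ideal disjoint from the denominators is prime. -/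
theorem IsPrimeTwoSided.span_image (S : Submonoid R) (φ : Λ →ₐ[R] B)
    [IsLocalizedModule S φ.toLinearMap] {P : TwoSidedIdeal Λ} (hP : IsPrimeTwoSided P)
    (hPS : ∀ s ∈ S, algebraMap R Λ s ∉ P) :
    IsPrimeTwoSided (TwoSidedIdeal.span (φ '' P)) := by
  have hφ := hP.map_mem_span_image_iff S φ hPS
  refine ⟨fun h => hP.1 ?_, fun x y h => ?_⟩
  · rw [← TwoSidedIdeal.one_mem_iff, ← hφ, h]
    exact TwoSidedIdeal.mem_top _
  · have key (x : B) {s : R} (hs : s ∈ S) {a : Λ} (hx : s • x = φ a) (ha : a ∈ P) :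
        x ∈ TwoSidedIdeal.span (φ '' P) :=
      (P.mem_span_image_iff_of_isLocalizedModule S φ x).2 ⟨s, hs, a, ha, hx⟩
    obtain ⟨s, hs, a, hx⟩ := φ.exists_smul_eq_of_isLocalizedModule S x
    obtain ⟨t, ht, b, hy⟩ := φ.exists_smul_eq_of_isLocalizedModule S y
    refine (hP.2 a b fun z => ?_).imp (key x hs hx) (key y ht hy)
    rw [← hφ, map_mul, map_mul, ← hx, ← hy, smul_mul_assoc, smul_mul_smul_comm]
    exact TwoSidedIdeal.algebra_smul_mem _ _ (h _)

/-- Extending the contraction of a two-sided ideal of a localization gives back the ideal. -/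
theorem TwoSidedIdeal.span_image_comap_of_isLocalizedModule (S : Submonoid R) (φ : Λ →ₐ[R] B)
    [IsLocalizedModule S φ.toLinearMap] (M : TwoSidedIdeal B) :
    TwoSidedIdeal.span (φ '' (M.comap φ : TwoSidedIdeal Λ)) = M := by
  refine le_antisymm (TwoSidedIdeal.span_le.2 ?_) fun x hx => ?_
  · rintro _ ⟨a, ha, rfl⟩
    exact (TwoSidedIdeal.mem_comap φ).1 ha
  · obtain ⟨s, hs, a, h⟩ := φ.exists_smul_eq_of_isLocalizedModule S x
    refine (TwoSidedIdeal.mem_span_image_iff_of_isLocalizedModule S φ _ x).2 ⟨s, hs, a, ?_, h⟩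
    rw [TwoSidedIdeal.mem_comap, ← h]
    exact M.algebra_smul_mem _ hx

/-- The contraction of a prime two-sided ideal of a localization is prime. -/
theorem IsPrimeTwoSided.comap_of_isLocalizedModule (S : Submonoid R) (φ : Λ →ₐ[R] B)
    [IsLocalizedModule S φ.toLinearMap] {M : TwoSidedIdeal B} (hM : IsPrimeTwoSided M) :
    IsPrimeTwoSided (M.comap φ : TwoSidedIdeal Λ) := by
  refine ⟨fun h => hM.1 ?_, fun a b h => ?_⟩
  · rw [← TwoSidedIdeal.one_mem_iff, ← map_one φ, ← TwoSidedIdeal.mem_comap, h]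
    exact TwoSidedIdeal.mem_top _
  · simp only [TwoSidedIdeal.mem_comap] at h ⊢
    refine hM.2 _ _ fun x => ?_
    obtain ⟨s, hs, z, hx⟩ := φ.exists_smul_eq_of_isLocalizedModule S x
    obtain ⟨y, hy⟩ := ((Module.End.isUnit_iff _).1
      (IsLocalizedModule.map_units φ.toLinearMap (⟨s, hs⟩ : S))).2 (1 : B)
    have hy : s • y = 1 := hy
    have hxy : φ a * x * φ b = φ (a * z * b) * y := by
      rw [map_mul, map_mul, ← hx, mul_smul_comm, smul_mul_assoc, smul_mul_assoc, ← mul_smul_comm,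
        hy, mul_one]
    rw [hxy]
    exact M.mul_mem_right _ _ (h z)

end Localization

/-- For a noetherian algebra `Λ` over a commutative noetherian ring `R` (contained in the
center of `Λ`) and a prime ideal `p` of `R`, the map `Q ↦ QΛ_p` restricts to a bijection from
the prime two-sided ideals `P` of `Λ` with `P ∩ R = p` onto the maximal two-sided ideals of
`Λ_p`. -/
theorem prime_twoSidedIdeals_over_p_biject_maximal
    (R : Type u) [CommRing R] [IsNoetherianRing R]
    (Λ : Type u) [Ring Λ] [Algebra R Λ]
    (hRcenter : Function.Injective (algebraMap R Λ)) [Module.Finite R Λ]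
    (p : Ideal R) [p.IsPrime] :
    Set.BijOn
      (fun Q : TwoSidedIdeal Λ => TwoSidedIdeal.span (localizationRingHom R Λ p '' Q))
      {P : TwoSidedIdeal Λ | IsPrimeTwoSided P ∧ ∀ r : R, algebraMap R Λ r ∈ P ↔ r ∈ p}
      {Q' : TwoSidedIdeal (LocalizedAlg R Λ p) | IsMaximalTwoSided Q'} := by
  let φ : Λ →ₐ[R] LocalizedAlg R Λ p := Algebra.TensorProduct.includeRight
  have : IsLocalizedModule p.primeCompl φ.toLinearMap :=
    inferInstanceAs (IsLocalizedModule p.primeCompl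
      (TensorProduct.mk R (Localization.AtPrime p) Λ 1))
  have hφ (r : R) : φ (algebraMap R Λ r) = algebraMap (Localization.AtPrime p) _
      (algebraMap R (Localization.AtPrime p) r) := by
    rw [φ.commutes, ← IsScalarTower.algebraMap_apply]
  refine ⟨fun P ⟨hP, hPp⟩ => ?_, fun P ⟨hP, hPp⟩ P' ⟨hP', hPp'⟩ h => ?_, fun M hM => ?_⟩
  · refine (hP.span_image p.primeCompl φ fun s hs h => hs ((hPp s).1 h)).isMaximalTwoSided
      (IsLocalRing.maximalIdeal (Localization.AtPrime p)) fun r hr => ?_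
    rw [← Localization.AtPrime.map_eq_maximalIdeal] at hr
    have hle : p.map (algebraMap R (Localization.AtPrime p)) ≤ Ideal.comap
        (algebraMap (Localization.AtPrime p) (LocalizedAlg R Λ p))
        (TwoSidedIdeal.span (φ '' P)).asIdeal := by
      refine Ideal.map_le_iff_le_comap.2 fun r hr => ?_
      rw [Ideal.mem_comap, Ideal.mem_comap, TwoSidedIdeal.mem_asIdeal, ← hφ]
      exact TwoSidedIdeal.subset_span ⟨_, (hPp r).2 hr, rfl⟩
    exact hle hr
  · have h : TwoSidedIdeal.span (φ '' P) = TwoSidedIdeal.span (φ '' P') := h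
    ext b
    rw [← hP.map_mem_span_image_iff p.primeCompl φ fun s hs h => hs ((hPp s).1 h), h,
      hP'.map_mem_span_image_iff p.primeCompl φ fun s hs h => hs ((hPp' s).1 h)]
  · refine ⟨M.comap φ, ⟨hM.isPrimeTwoSided.comap_of_isLocalizedModule p.primeCompl φ, fun r => ?_⟩,
      M.span_image_comap_of_isLocalizedModule p.primeCompl φ⟩
    rw [TwoSidedIdeal.mem_comap, hφ]
    refine ⟨fun h => ?_, fun h => hM.algebraMap_mem ?_⟩
    · by_contra hr
      have hu := (IsLocalization.map_units (Localization.AtPrime p)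
        (⟨r, hr⟩ : p.primeCompl)).map (algebraMap _ (LocalizedAlg R Λ p))
      obtain ⟨y, hy⟩ := hu.exists_right_inv
      exact hM.1 (M.one_mem_iff.1 (hy ▸ M.mul_mem_right _ y h))
    · rw [← Localization.AtPrime.map_eq_maximalIdeal]
      exact Ideal.mem_map_of_mem _ h
end
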